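/- arXiv:1202.3369 — 2 statements merged into one kernel-verified Lean document; each statement's English description precedes it below -/
import Mathlib

section
/- Suppose K is an infinite field. Then N_B has a maximum Jordan type: there exists A₀ ∈ N_B such that rank A^m ≤ rank A₀^m for every A ∈ N_B and every m ∈ ℕ. -/
open Matrix

/-- The `n × n` nilpotent matrix in Jordan canonical form whose Jordan blocks have
sizes `μ 0, μ 1, ..., μ (t-1)`, realized on the index type `Σ i : Fin t, Fin (μ i)`. -/
def jordanMatrix (K : Type*) [Field K] (t : ℕ) (μ : Fin t → ℕ) :
    Matrix (Σ i : Fin t, Fin (μ i)) (Σ i : Fin t, Fin (μ i)) K :=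
  fun p q => if p.1 = q.1 ∧ (p.2 : ℕ) + 1 = (q.2 : ℕ) then 1 else 0

open Polynomial in
/-- Lower semicontinuity of the rank along a polynomial curve of matrices. -/
lemma finite_setOf_rank_eval_lt {K n : Type*} [Field K] [Fintype n] [DecidableEq n]
    (M : Matrix n n K[X]) (s₀ : K) :
    {s : K | (M.map (eval s)).rank < (M.map (eval s₀)).rank}.Finite := by
  set N := M.map (eval s₀) with hN
  set r := N.rank
  obtain ⟨P, Q, hPQ⟩ : ∃ (P : Matrix (Fin r) n K) (Q : Matrix n (Fin r) K), P * N * Q = 1 := by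
    let b : Module.Basis (Fin r) K (LinearMap.range N.mulVecLin) := Module.finBasisOfFinrankEq _ _ rfl
    choose q hq using fun i => (b i).2
    let g : (Fin r → K) →ₗ[K] (n → K) := (Pi.basisFun K (Fin r)).constr K q
    have hg : N.mulVecLin ∘ₗ g = (LinearMap.range N.mulVecLin).subtype ∘ₗ b.equivFun.symm := by
      refine (Pi.basisFun K (Fin r)).ext fun i => ?_
      simp only [LinearMap.comp_apply, g, Module.Basis.constr_basis, hq]
      simp
    obtain ⟨p, hp⟩ := LinearMap.exists_leftInverse_of_injective (N.mulVecLin ∘ₗ g) (by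
      rw [hg, LinearMap.ker_eq_bot, LinearMap.coe_comp]
      exact Subtype.val_injective.comp b.equivFun.symm.injective)
    refine ⟨LinearMap.toMatrix' p, LinearMap.toMatrix' g, ?_⟩
    have h : N = LinearMap.toMatrix' N.mulVecLin := (LinearMap.toMatrix'_toLin' N).symm
    rw [h, ← LinearMap.toMatrix'_comp, ← LinearMap.toMatrix'_comp, LinearMap.comp_assoc, hp,
      LinearMap.toMatrix'_id]
  have heval (s : K) :
      (P.map C * M * Q.map C).det.eval s = (P * M.map (eval s) * Q).det := by
    rw [← coe_evalRingHom, RingHom.map_det]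
    congr 1
    simp only [RingHom.mapMatrix_apply, Matrix.map_mul, Matrix.map_map]
    simp [Function.comp_def]
  have hne : (P.map C * M * Q.map C).det ≠ 0 := by
    intro h
    have := heval s₀
    rw [h, ← hN, hPQ] at this
    simp at this
  refine (finite_setOfPred_isRoot hne).subset fun s hs => ?_
  by_contra hroot
  rw [Set.mem_ofPred_eq, IsRoot.def, heval] at hroot
  have h1 : (P * M.map (eval s) * Q).rank = r := by
    rw [Matrix.rank_of_isUnit _ ((Matrix.isUnit_iff_isUnit_det _).2 (isUnit_iff_ne_zero.2 hroot)),
      Fintype.card_fin]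
  have h2 : (P * M.map (eval s) * Q).rank ≤ (M.map (eval s)).rank :=
    (Matrix.rank_mul_le_left _ _).trans (Matrix.rank_mul_le_right _ _)
  exact absurd hs (by simp only [Set.mem_ofPred_eq]; omega)

/-- A linear space of nilpotent matrices over an infinite field has a maximum Jordan type. -/
lemma exists_max_rank_pow_of_submodule {K n : Type*} [Field K] [Infinite K] [Fintype n]
    [DecidableEq n] (U : Submodule K (Matrix n n K)) (hU : ∀ A ∈ U, IsNilpotent A) :
    ∃ A₀ ∈ U, ∀ A ∈ U, ∀ m : ℕ, (A ^ m).rank ≤ (A₀ ^ m).rank := by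
  classical
  set N := Fintype.card n
  have hpow (A : Matrix n n K) (hA : A ∈ U) (m : ℕ) (hm : N ≤ m) : A ^ m = 0 := by
    have h := (Matrix.isNilpotent_charpoly_sub_pow_of_isNilpotent (hU A hA)).eq_zero
    rw [sub_eq_zero] at h
    have h2 := Matrix.aeval_self_charpoly A
    rw [h, map_pow, Polynomial.aeval_X] at h2
    exact pow_eq_zero_of_le hm h2
  let S : Set ℕ := (fun A : Matrix n n K => ∑ m ∈ Finset.range N, (A ^ m).rank) '' U
  have hne : S.Nonempty := ⟨_, 0, U.zero_mem, rfl⟩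
  have hbdd : BddAbove S := by
    refine ⟨∑ m ∈ Finset.range N, N, ?_⟩
    rintro _ ⟨A, -, rfl⟩
    exact Finset.sum_le_sum fun m _ => Matrix.rank_le_card_width _
  obtain ⟨A₀, hA₀, hmax⟩ := Nat.sSup_mem hne hbdd
  refine ⟨A₀, hA₀, fun A hA m => ?_⟩
  by_contra! hlt
  have hm : m < N := by
    by_contra! hm
    simp [hpow A hA m hm] at hlt
  let L : Matrix n n (Polynomial K) :=
    A₀.map Polynomial.C + (Polynomial.X : Polynomial K) • (A - A₀).map Polynomial.C
  have hL (s : K) (k : ℕ) : (L ^ k).map (Polynomial.eval s) = (A₀ + s • (A - A₀)) ^ k := by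
    have h : L.map (Polynomial.eval s) = A₀ + s • (A - A₀) := by
      ext i j
      simp [L]
    rw [← h, ← Polynomial.coe_evalRingHom]
    exact map_pow (Polynomial.evalRingHom s).mapMatrix L k
  have hfin : ((⋃ k ∈ Finset.range N, {s : K | ((L ^ k).map (Polynomial.eval s)).rank <
      ((L ^ k).map (Polynomial.eval 0)).rank}) ∪ {s : K |
      ((L ^ m).map (Polynomial.eval s)).rank < ((L ^ m).map (Polynomial.eval 1)).rank}).Finite :=
    ((Finset.range N).finite_toSet.biUnion fun k _ => finite_setOf_rank_eval_lt _ _).union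
      (finite_setOf_rank_eval_lt _ _)
  obtain ⟨s, hs⟩ := hfin.exists_notMem
  simp only [hL, Set.mem_union, Set.mem_iUnion, Set.mem_ofPred_eq, not_or, not_exists, not_lt,
    zero_smul, add_zero, one_smul, add_sub_cancel, Finset.mem_range] at hs
  have hle := le_csSup hbdd
    ⟨A₀ + s • (A - A₀), U.add_mem hA₀ (U.smul_mem _ (U.sub_mem hA hA₀)), rfl⟩
  rw [← hmax] at hle
  refine absurd hle (not_le.2 ?_)
  exact Finset.sum_lt_sum (fun k hk => hs.1 k (Finset.mem_range.1 hk))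
    ⟨m, Finset.mem_range.2 hm, hlt.trans_le hs.2⟩

/-- A nilpotent endomorphism preserving a decreasing family of subspaces can be made strictly
triangular in a system of vectors adapted to the family. -/
lemma exists_adapted_triangular {K V : Type*} [Field K] [AddCommGroup V] [Module K V]
    (A : Module.End K V) (hA : IsNilpotent A) {t : ℕ} (S : Fin t → Submodule K V)
    (hS : Monotone S) (hinv : ∀ i, ∀ v ∈ S i, A v ∈ S i) (e : Fin t → V)
    (he : LinearIndependent K e) (heS : ∀ i, e i ∈ S i) :
    ∃ f : Fin t → V, LinearIndependent K f ∧ (∀ i, f i ∈ S i) ∧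
      ∀ i, A (f i) ∈ Submodule.span K (f '' Set.Iio i) := by
  classical
  induction t with
  | zero => exact ⟨e, he, heS, fun i => i.elim0⟩
  | succ t ih =>
    obtain ⟨f, hf, hfS, hfA⟩ := ih (fun i => S i.castSucc) (fun i j h => hS h)
      (fun i => hinv i.castSucc) (fun i => e i.castSucc)
      (he.comp _ (Fin.castSucc_injective t)) (fun i => heS i.castSucc)
    set F := Submodule.span K (Set.range f)
    obtain ⟨j, hj⟩ : ∃ j, e j ∉ F := by
      by_contra! h
      have hle : Submodule.span K (Set.range e) ≤ F :=
        Submodule.span_le.2 (Set.range_subset_iff.2 h)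
      have : FiniteDimensional K F := FiniteDimensional.span_of_finite K (Set.finite_range f)
      have h1 := Submodule.finrank_mono hle
      rw [finrank_span_eq_card he, finrank_span_eq_card hf] at h1
      simp at h1
    have hex : ∃ m, (A ^ m) (e j) ∈ F := by
      obtain ⟨N, hN⟩ := hA
      exact ⟨N, by simp [hN]⟩
    obtain ⟨m, hm⟩ : ∃ m, Nat.find hex = m + 1 := by
      refine Nat.exists_eq_succ_of_ne_zero fun h => hj ?_
      simpa [h] using Nat.find_spec hex
    have hx : (A ^ m) (e j) ∉ F := Nat.find_min hex (by omega)
    have hAx : A ((A ^ m) (e j)) ∈ F := by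
      have := Nat.find_spec hex
      rwa [hm, pow_succ'] at this
    have hxS (k : ℕ) : (A ^ k) (e j) ∈ S (Fin.last t) := by
      induction k with
      | zero => exact hS (Fin.le_last j) (heS j)
      | succ k ihk => rw [pow_succ']; exact hinv _ _ ihk
    refine ⟨Fin.snoc f ((A ^ m) (e j)), linearIndependent_finSnoc.2 ⟨hf, hx⟩, ?_, ?_⟩
    · intro i
      refine Fin.lastCases ?_ (fun i => ?_) i
      · simpa using hxS m
      · simpa using hfS i
    · intro i
      refine Fin.lastCases ?_ (fun i => ?_) i
      · rw [Fin.snoc_last]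
        refine Submodule.span_mono ?_ hAx
        rintro _ ⟨k, rfl⟩
        exact ⟨k.castSucc, Fin.castSucc_lt_last k, by simp⟩
      · rw [Fin.snoc_castSucc]
        refine Submodule.span_mono ?_ (hfA i)
        rintro _ ⟨k, hk, rfl⟩
        exact ⟨k.castSucc, Fin.castSucc_lt_castSucc_iff.2 hk, by simp⟩

section jordanMatrix

variable {K : Type*} [Field K] {t : ℕ} {μ : Fin t → ℕ}

lemma mul_jordanMatrix_apply_zero {m : Type*} (M : Matrix m (Σ i : Fin t, Fin (μ i)) K) (p : m)
    (i : Fin t) (h : 0 < μ i) : (M * jordanMatrix K t μ) p ⟨i, 0, h⟩ = 0 := by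
  simp [Matrix.mul_apply, jordanMatrix]

lemma mul_jordanMatrix_apply_succ {m : Type*} (M : Matrix m (Σ i : Fin t, Fin (μ i)) K) (p : m)
    (i : Fin t) (a : ℕ) (h : a + 1 < μ i) :
    (M * jordanMatrix K t μ) p ⟨i, a + 1, h⟩ = M p ⟨i, a, by omega⟩ := by
  rw [Matrix.mul_apply, Finset.sum_eq_single ⟨i, a, by omega⟩]
  · simp [jordanMatrix]
  · rintro ⟨j, b⟩ - hne
    rw [jordanMatrix, if_neg, mul_zero]
    rintro ⟨h1, h2⟩
    obtain rfl : j = i := h1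
    exact hne (by congr 1; ext; simpa using h2)
  · simp

lemma jordanMatrix_pow_apply (k : ℕ) (p q : Σ i : Fin t, Fin (μ i)) :
    (jordanMatrix K t μ ^ k) p q = if p.1 = q.1 ∧ (p.2 : ℕ) + k = (q.2 : ℕ) then 1 else 0 := by
  induction k generalizing q with
  | zero =>
    rw [pow_zero, Matrix.one_apply]
    obtain ⟨i, a⟩ := p
    obtain ⟨j, b⟩ := q
    congr 1
    rw [eq_iff_iff, Sigma.mk.injEq]
    refine and_congr_right fun h => ?_
    subst h
    simp [Fin.ext_iff]
  | succ k ih =>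
    rw [pow_succ]
    obtain ⟨j, b, hb⟩ := q
    cases b with
    | zero => rw [mul_jordanMatrix_apply_zero]; simp
    | succ b =>
      rw [mul_jordanMatrix_apply_succ, ih]
      simp [← add_assoc]

lemma isNilpotent_jordanMatrix : IsNilpotent (jordanMatrix K t μ) := by
  refine ⟨∑ i, μ i, ?_⟩
  ext p q
  rw [jordanMatrix_pow_apply, if_neg, Matrix.zero_apply]
  rintro ⟨-, h⟩
  have := Finset.single_le_sum (fun i _ => Nat.zero_le (μ i)) (Finset.mem_univ q.1)
  have := q.2.2
  omega

/-- The eigenvector of the Jordan matrix at the end of the `i`-th Jordan chain. -/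
def jordanKerVec (K : Type*) [Field K] (hpos : ∀ i, 0 < μ i) (i : Fin t) :
    (Σ i : Fin t, Fin (μ i)) → K :=
  Pi.single ⟨i, 0, hpos i⟩ 1

lemma linearIndependent_jordanKerVec (hpos : ∀ i, 0 < μ i) :
    LinearIndependent K (jordanKerVec K hpos) := by
  have h : Function.Injective fun i : Fin t => (⟨i, 0, hpos i⟩ : Σ i : Fin t, Fin (μ i)) :=
    fun i j h => congrArg Sigma.fst h
  have := (Pi.basisFun K (Σ i : Fin t, Fin (μ i))).linearIndependent.comp _ h
  simpa [Function.comp_def] using! this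

lemma jordanMatrix_mulVec_jordanKerVec (hpos : ∀ i, 0 < μ i) (i : Fin t) :
    jordanMatrix K t μ *ᵥ jordanKerVec K hpos i = 0 := by
  ext p
  simp [jordanKerVec, jordanMatrix]

lemma jordanKerVec_eq_pow_mulVec (hpos : ∀ i, 0 < μ i) (i : Fin t) :
    jordanKerVec K hpos i = jordanMatrix K t μ ^ (μ i - 1) *ᵥ
      Pi.single ⟨i, μ i - 1, Nat.sub_lt (hpos i) one_pos⟩ 1 := by
  ext ⟨j, a⟩
  rw [Matrix.mulVec_single_one, Matrix.col_apply, jordanMatrix_pow_apply, jordanKerVec,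
    Pi.single_apply]
  congr 1
  rw [eq_iff_iff, Sigma.mk.injEq]
  refine and_congr_right fun h => ?_
  subst h
  simp [Fin.ext_iff]

lemma eq_sum_of_jordanMatrix_mulVec_eq_zero (hpos : ∀ i, 0 < μ i)
    {v : (Σ i : Fin t, Fin (μ i)) → K} (hv : jordanMatrix K t μ *ᵥ v = 0) :
    v = ∑ i, v ⟨i, 0, hpos i⟩ • jordanKerVec K hpos i := by
  ext ⟨j, a, ha⟩
  rw [Finset.sum_apply, Finset.sum_eq_single j]
  · cases a with
    | zero => simp [jordanKerVec]
    | succ a =>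
      have h := congrFun hv ⟨j, a, by omega⟩
      rw [Matrix.mulVec, dotProduct, Finset.sum_eq_single ⟨j, a + 1, ha⟩] at h
      · simpa [jordanMatrix, jordanKerVec] using h
      · rintro ⟨i, b⟩ - hne
        rw [jordanMatrix, if_neg, zero_mul]
        rintro ⟨h1, h2⟩
        obtain rfl : j = i := h1
        exact hne (by congr 1; ext; simpa using h2.symm)
      · simp
  · intro i _ hi
    have : (⟨j, a, ha⟩ : Σ i : Fin t, Fin (μ i)) ≠ ⟨i, 0, hpos i⟩ :=
      fun h => hi (congrArg Sigma.fst h).symm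
    simp [jordanKerVec, this]
  · simp

/-- The centralizer elements acting strictly triangularly on the kernel of the Jordan matrix. -/
def triangularCentralizer (K : Type*) [Field K] (hpos : ∀ i, 0 < μ i) :
    Submodule K (Matrix (Σ i : Fin t, Fin (μ i)) (Σ i : Fin t, Fin (μ i)) K) where
  carrier := {X | X * jordanMatrix K t μ = jordanMatrix K t μ * X ∧
    ∀ i, X *ᵥ jordanKerVec K hpos i ∈ Submodule.span K (jordanKerVec K hpos '' Set.Iio i)}
  zero_mem' := by simp
  add_mem' := by
    rintro X Y ⟨hX, hX'⟩ ⟨hY, hY'⟩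
    refine ⟨by rw [add_mul, mul_add, hX, hY], fun i => ?_⟩
    rw [Matrix.add_mulVec]
    exact Submodule.add_mem _ (hX' i) (hY' i)
  smul_mem' := by
    rintro c X ⟨hX, hX'⟩
    refine ⟨by rw [Matrix.smul_mul, Matrix.mul_smul, hX], fun i => ?_⟩
    rw [Matrix.smul_mulVec]
    exact Submodule.smul_mem _ c (hX' i)

lemma isNilpotent_of_mem_triangularCentralizer (hpos : ∀ i, 0 < μ i)
    {X : Matrix (Σ i : Fin t, Fin (μ i)) (Σ i : Fin t, Fin (μ i)) K}
    (hX : X ∈ triangularCentralizer K hpos) : IsNilpotent X := by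
  obtain ⟨hcomm, htri⟩ := hX
  have hvec (i : Fin t) : ∀ k : ℕ, (i : ℕ) < k → X ^ k *ᵥ jordanKerVec K hpos i = 0 := by
    induction i using WellFoundedLT.induction with
    | _ i ih =>
      intro k hk
      obtain ⟨k, rfl⟩ := Nat.exists_eq_succ_of_ne_zero (Nat.ne_zero_of_lt hk)
      rw [Nat.succ_eq_add_one, pow_succ, ← Matrix.mulVec_mulVec]
      have hle : Submodule.span K (jordanKerVec K hpos '' Set.Iio i) ≤
          LinearMap.ker (X ^ k).mulVecLin := by
        rw [Submodule.span_le]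
        rintro _ ⟨j, hj, rfl⟩
        exact ih j hj k (lt_of_lt_of_le (Fin.lt_def.1 hj) (Nat.lt_succ_iff.1 hk))
      exact hle (htri i)
  have hker {v : (Σ i : Fin t, Fin (μ i)) → K} (hv : jordanMatrix K t μ *ᵥ v = 0) :
      X ^ t *ᵥ v = 0 := by
    rw [eq_sum_of_jordanMatrix_mulVec_eq_zero hpos hv, Matrix.mulVec_sum]
    exact Finset.sum_eq_zero fun i _ => by rw [Matrix.mulVec_smul, hvec i t i.2, smul_zero]
  have hpow : ∀ (k : ℕ) (v : (Σ i : Fin t, Fin (μ i)) → K),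
      jordanMatrix K t μ ^ k *ᵥ v = 0 → X ^ (t * k) *ᵥ v = 0 := by
    intro k
    induction k with
    | zero => intro v hv; simpa using hv
    | succ k ih =>
      intro v hv
      have h := ih (jordanMatrix K t μ *ᵥ v) (by rwa [Matrix.mulVec_mulVec, ← pow_succ])
      rw [Matrix.mulVec_mulVec, (Commute.pow_left hcomm (t * k)).eq, ← Matrix.mulVec_mulVec] at h
      rw [mul_add, mul_one, add_comm, pow_add, ← Matrix.mulVec_mulVec]
      exact hker h
  obtain ⟨N, hN⟩ := isNilpotent_jordanMatrix (K := K) (μ := μ)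
  refine ⟨t * N, Matrix.ext_of_mulVec_single fun q => ?_⟩
  rw [hpow N _ (by rw [hN, Matrix.zero_mulVec]), Matrix.zero_mulVec]

lemma isUnit_of_commute_jordanMatrix
    {P : Matrix (Σ i : Fin t, Fin (μ i)) (Σ i : Fin t, Fin (μ i)) K}
    (hcomm : P * jordanMatrix K t μ = jordanMatrix K t μ * P)
    (hker : ∀ v, jordanMatrix K t μ *ᵥ v = 0 → P *ᵥ v = 0 → v = 0) : IsUnit P := by
  have hpow : ∀ (k : ℕ) (v : (Σ i : Fin t, Fin (μ i)) → K),
      jordanMatrix K t μ ^ k *ᵥ v = 0 → P *ᵥ v = 0 → v = 0 := by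
    intro k
    induction k with
    | zero => intro v hv _; simpa using hv
    | succ k ih =>
      intro v hv hP
      refine hker v (ih _ (by rwa [Matrix.mulVec_mulVec, ← pow_succ]) ?_) hP
      rw [Matrix.mulVec_mulVec, hcomm, ← Matrix.mulVec_mulVec, hP, Matrix.mulVec_zero]
  obtain ⟨N, hN⟩ := isNilpotent_jordanMatrix (K := K) (μ := μ)
  rw [← Matrix.mulVec_injective_iff_isUnit]
  refine (injective_iff_map_eq_zero P.mulVecLin).2 fun v hv => ?_
  exact hpow N v (by rw [hN, Matrix.zero_mulVec]) hv

/-- Every nilpotent element of the centralizer is conjugate, by a unit of the centralizer, to one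
acting strictly triangularly on the kernel of the Jordan matrix. -/
lemma exists_conj_mem_triangularCentralizer (hpos : ∀ i, 0 < μ i)
    (hmono : ∀ i j : Fin t, i ≤ j → μ j ≤ μ i)
    {A : Matrix (Σ i : Fin t, Fin (μ i)) (Σ i : Fin t, Fin (μ i)) K}
    (hcomm : A * jordanMatrix K t μ = jordanMatrix K t μ * A) (hA : IsNilpotent A) :
    ∃ P : (Matrix (Σ i : Fin t, Fin (μ i)) (Σ i : Fin t, Fin (μ i)) K)ˣ,
      (P⁻¹).val * A * P.val ∈ triangularCentralizer K hpos := by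
  set J := jordanMatrix K t μ with hJ
  set e := jordanKerVec K hpos with he
  let S : Fin t → Submodule K ((Σ i : Fin t, Fin (μ i)) → K) := fun i =>
    LinearMap.ker J.mulVecLin ⊓ LinearMap.range (J ^ (μ i - 1)).mulVecLin
  have hS : Monotone S := by
    intro i j hij
    refine inf_le_inf_left _ ?_
    rintro _ ⟨v, rfl⟩
    refine ⟨J ^ (μ i - μ j) *ᵥ v, ?_⟩
    have := hmono i j hij
    have := hpos j
    rw [Matrix.mulVecLin_apply, Matrix.mulVec_mulVec, ← pow_add, Matrix.mulVecLin_apply]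
    congr 2
    omega
  obtain ⟨f, hf, hfS, hfA⟩ := exists_adapted_triangular (Matrix.toLin' A)
    ((Matrix.isNilpotent_toLin'_iff A).2 hA) S hS (by
      rintro i _ ⟨hv, ⟨w, rfl⟩⟩
      simp only [SetLike.mem_coe, LinearMap.mem_ker, Matrix.mulVecLin_apply] at hv
      rw [Matrix.mulVecLin_apply, Matrix.toLin'_apply]
      refine ⟨?_, A *ᵥ w, ?_⟩
      · rw [SetLike.mem_coe, LinearMap.mem_ker, Matrix.mulVecLin_apply, Matrix.mulVec_mulVec,
          ← hcomm, ← Matrix.mulVec_mulVec, hv, Matrix.mulVec_zero]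
      · rw [Matrix.mulVecLin_apply, Matrix.mulVec_mulVec, Matrix.mulVec_mulVec,
          (Commute.pow_right hcomm (μ i - 1)).eq])
    e (linearIndependent_jordanKerVec hpos)
    (fun i => ⟨jordanMatrix_mulVec_jordanKerVec hpos i, _, (jordanKerVec_eq_pow_mulVec hpos i).symm⟩)
  choose g hg using fun i => (hfS i).2
  have hJf (i : Fin t) : J *ᵥ f i = 0 := (hfS i).1
  simp only [Matrix.mulVecLin_apply] at hg
  let P : Matrix (Σ i : Fin t, Fin (μ i)) (Σ i : Fin t, Fin (μ i)) K :=
    Matrix.of fun p q => (J ^ (μ q.1 - 1 - q.2) *ᵥ g q.1) p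
  have hPe (i : Fin t) : P *ᵥ e i = f i := by
    ext p
    simp [he, jordanKerVec, P, hg]
  have hJP (p q) : (J * P) p q = (J ^ (μ q.1 - 1 - q.2 + 1) *ᵥ g q.1) p := by
    rw [pow_succ', ← Matrix.mulVec_mulVec]
    rfl
  have hPJ : P * J = J * P := by
    ext p ⟨i, a, ha⟩
    rw [hJP]
    cases a with
    | zero =>
      rw [hJ, mul_jordanMatrix_apply_zero, ← hJ]
      simp [pow_succ', ← Matrix.mulVec_mulVec, hg, hJf]
    | succ a =>
      rw [hJ, mul_jordanMatrix_apply_succ, ← hJ]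
      simp only [P, Matrix.of_apply]
      congr 3
      omega
  have hP : IsUnit P := by
    refine isUnit_of_commute_jordanMatrix hPJ fun v hv hPv => ?_
    have hsum := eq_sum_of_jordanMatrix_mulVec_eq_zero hpos hv
    rw [hsum, Matrix.mulVec_sum] at hPv
    simp only [Matrix.mulVec_smul, ← he, hPe] at hPv
    have h0 := Fintype.linearIndependent_iff.1 hf _ hPv
    rw [hsum]
    exact Finset.sum_eq_zero fun i _ => by rw [h0 i, zero_smul]
  obtain ⟨u, hu⟩ := hP
  rw [← hu] at hPe hPJ
  have hinv (i : Fin t) : (u⁻¹).val *ᵥ f i = e i := by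
    rw [← hPe, Matrix.mulVec_mulVec, Units.inv_mul, Matrix.one_mulVec]
  have hcomm_unit : Commute u.val J := hPJ
  refine ⟨u, (hcomm_unit.units_inv_left.mul_left hcomm).mul_left hcomm_unit, fun i => ?_⟩
  rw [← he, ← Matrix.mulVec_mulVec, hPe, ← Matrix.mulVec_mulVec]
  have h := Submodule.mem_map_of_mem (f := (u⁻¹).val.mulVecLin) (hfA i)
  rw [Submodule.map_span, Set.image_image] at h
  simpa only [Matrix.mulVecLin_apply, Matrix.toLin'_apply, hinv] using h

end jordanMatrix

/-- If `K` is an infinite field then `N_B`, the set of nilpotent matrices commuting with the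
Jordan matrix `J` of type `B = (μ_1 ≥ ... ≥ μ_t)`, has a maximum Jordan type: there exists
`A₀ ∈ N_B` with `rank A^m ≤ rank A₀^m` for every `A ∈ N_B` and every `m`. -/
theorem exists_max_jordan_type
    (K : Type*) [Field K] [Infinite K]
    (t : ℕ) (μ : Fin t → ℕ) (hpos : ∀ i, 0 < μ i)
    (hmono : ∀ i j : Fin t, i ≤ j → μ j ≤ μ i) :
    ∃ A₀ : Matrix (Σ i : Fin t, Fin (μ i)) (Σ i : Fin t, Fin (μ i)) K,
      A₀ * jordanMatrix K t μ = jordanMatrix K t μ * A₀ ∧ IsNilpotent A₀ ∧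
      ∀ A : Matrix (Σ i : Fin t, Fin (μ i)) (Σ i : Fin t, Fin (μ i)) K,
        A * jordanMatrix K t μ = jordanMatrix K t μ * A → IsNilpotent A →
        ∀ m : ℕ, (A ^ m).rank ≤ (A₀ ^ m).rank := by
  obtain ⟨A₀, hA₀, hmax⟩ := exists_max_rank_pow_of_submodule (triangularCentralizer K hpos)
    fun _ => isNilpotent_of_mem_triangularCentralizer hpos
  refine ⟨A₀, hA₀.1, isNilpotent_of_mem_triangularCentralizer hpos hA₀, fun A hA hnil m => ?_⟩
  obtain ⟨P, hP⟩ := exists_conj_mem_triangularCentralizer hpos hmono hA hnil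
  have h := hmax _ hP m
  have hdet (Q : (Matrix (Σ i : Fin t, Fin (μ i)) (Σ i : Fin t, Fin (μ i)) K)ˣ) :
      IsUnit Q.val.det := (Matrix.isUnit_iff_isUnit_det _).1 Q.isUnit
  rwa [Units.conj_pow', Matrix.rank_mul_eq_left_of_isUnit_det _ _ (hdet P),
    Matrix.rank_mul_eq_right_of_isUnit_det _ _ (hdet P⁻¹)] at h
end

section
/- Suppose K is an infinite field. Then every A ∈ N_B satisfies rank A ≤ n − r_B, and there exists A ∈ N_B with rank A = n − r_B (i.e. with exactly r_B Jordan blocks); thus the maximal rank of an element of N_B is n − r_B. -/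
open Matrix

/-- `B = (μ_1 ≥ ... ≥ μ_t)` is a concatenation of `p` almost rectangular partitions:
there are cut points `0 = c_0 < c_1 < ... < c_p = t` such that on each segment
`[c_{k}, c_{k+1})` the parts of `μ` differ by at most `1`. -/
def IsConcatAR (t : ℕ) (μ : Fin t → ℕ) (p : ℕ) : Prop :=
  ∃ c : Fin (p + 1) → ℕ, c 0 = 0 ∧ c (Fin.last p) = t ∧ StrictMono c ∧
    ∀ k : Fin p, ∀ i j : Fin t,
      c k.castSucc ≤ (i : ℕ) → (i : ℕ) < c k.succ →
      c k.castSucc ≤ (j : ℕ) → (j : ℕ) < c k.succ →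
      μ i ≤ μ j + 1

/-- The nonzero entries of `A` lie at positions in the relation `R`. -/
def SupportedOn {ι K : Type*} [Zero K] (R : ι → ι → Prop) (A : Matrix ι ι K) : Prop :=
  ∀ p q, A p q ≠ 0 → R p q

lemma SupportedOn.mul {ι K : Type*} [Fintype ι] [Field K] {R : ι → ι → Prop} [IsTrans ι R]
    {A B : Matrix ι ι K} (hA : SupportedOn R A) (hB : SupportedOn R B) :
    SupportedOn R (A * B) := by
  intro p q h
  rw [Matrix.mul_apply] at h
  obtain ⟨x, -, hx⟩ := Finset.exists_ne_zero_of_sum_ne_zero h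
  exact _root_.trans (hA p x (left_ne_zero_of_mul hx)) (hB x q (right_ne_zero_of_mul hx))

lemma SupportedOn.pow {ι K : Type*} [Fintype ι] [DecidableEq ι] [Field K] {R : ι → ι → Prop}
    [IsTrans ι R] [Std.Refl R] {A : Matrix ι ι K} (hA : SupportedOn R A) (n : ℕ) :
    SupportedOn R (A ^ n) := by
  induction n with
  | zero =>
    intro p q h
    rw [pow_zero, Matrix.one_apply] at h
    obtain rfl : p = q := by by_contra h'; simp [h'] at h
    exact refl p
  | succ n ih => rw [pow_succ]; exact ih.mul hA

lemma SupportedOn.submatrix_pow {ι K : Type*} [Fintype ι] [DecidableEq ι] [Field K]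
    {R : ι → ι → Prop} [IsTrans ι R] [Std.Refl R] {A : Matrix ι ι K} (hA : SupportedOn R A)
    (x : ι) (I : Finset ι) (hI : ∀ q, q ∈ I ↔ R q x ∧ R x q) (n : ℕ) :
    (A ^ n).submatrix ((↑) : I → ι) ((↑) : I → ι) =
      (A.submatrix ((↑) : I → ι) ((↑) : I → ι)) ^ n := by
  induction n with
  | zero => rw [pow_zero, pow_zero, Matrix.submatrix_one _ Subtype.val_injective]
  | succ n ih =>
    rw [pow_succ, pow_succ, ← ih]
    ext p q
    simp only [Matrix.submatrix_apply, Matrix.mul_apply]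
    rw [Finset.sum_coe_sort I (fun y => (A ^ n) p y * A y q)]
    symm
    refine Finset.sum_subset (Finset.subset_univ I) fun y _ hy => ?_
    by_contra h
    refine hy ((hI y).2 ⟨?_, ?_⟩)
    · exact _root_.trans (hA _ _ (right_ne_zero_of_mul h)) ((hI _).1 q.2).1
    · exact _root_.trans ((hI _).1 p.2).2 (hA.pow n _ _ (left_ne_zero_of_mul h))

lemma SupportedOn.exists_vecMul_eq_zero {ι K : Type*} [Fintype ι] [DecidableEq ι] [Field K]
    {R : ι → ι → Prop} [IsTrans ι R] [Std.Refl R] {A : Matrix ι ι K} (hA : SupportedOn R A)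
    (hnil : IsNilpotent A) (x : ι) :
    ∃ w : ι → K, w ≠ 0 ∧ (∀ p, w p ≠ 0 → R p x ∧ R x p) ∧
      ∀ q, R q x → (w ᵥ* A) q = 0 := by
  classical
  let I : Finset ι := Finset.univ.filter fun q => R q x ∧ R x q
  have hI : ∀ q, q ∈ I ↔ R q x ∧ R x q := fun q => by simp [I]
  have hx : x ∈ I := (hI x).2 ⟨refl x, refl x⟩
  obtain ⟨n, hn⟩ := hnil
  set B := A.submatrix ((↑) : I → ι) ((↑) : I → ι) with hB
  have hdet : B.det = 0 := by
    have h : B ^ n = 0 := by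
      rw [hB, ← hA.submatrix_pow x I hI n, hn]; rfl
    have : Nonempty I := ⟨⟨x, hx⟩⟩
    have := congrArg Matrix.det h
    rw [Matrix.det_pow, Matrix.det_zero] at this
    exact eq_zero_of_pow_eq_zero this
  obtain ⟨v, hv, hvB⟩ := Matrix.exists_vecMul_eq_zero_iff.2 hdet
  refine ⟨fun p => if h : p ∈ I then v ⟨p, h⟩ else 0, ?_, ?_, ?_⟩
  · intro h
    apply hv
    ext p
    have := congrFun h p.1
    simpa using this
  · intro p hp
    by_cases h : p ∈ I
    · exact (hI p).1 h
    · simp [h] at hp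
  · intro q hq
    have key : ((fun p => if h : p ∈ I then v ⟨p, h⟩ else 0) ᵥ* A) q
        = ∑ p : I, v p * A p q := by
      simp only [Matrix.vecMul, dotProduct]
      rw [← Finset.sum_subset (Finset.subset_univ I)
        (fun y _ hy => by simp [hy]), ← Finset.sum_coe_sort I]
      exact Finset.sum_congr rfl fun y _ => by simp
    rw [key]
    by_cases h : q ∈ I
    · exact congrFun hvB ⟨q, h⟩
    · refine Finset.sum_eq_zero fun p _ => ?_
      by_contra hne
      exact h ((hI q).2 ⟨hq, _root_.trans ((hI _).1 p.2).2 (hA _ _ (right_ne_zero_of_mul hne))⟩)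

lemma Matrix.rank_add_card_le_rank_submatrix_add {ι K : Type*} [Fintype ι] [DecidableEq ι] [Field K]
    (A : Matrix ι ι K) (S : Finset ι) (hS : ∀ p q, p ∉ S → q ∈ S → A p q = 0) :
    A.rank + S.card ≤
      (A.submatrix ((↑) : S → ι) ((↑) : S → ι)).rank + Fintype.card ι := by
  set B := A.submatrix ((↑) : S → ι) ((↑) : S → ι)
  have h1 := LinearMap.finrank_range_add_finrank_ker A.mulVecLin
  have h2 := LinearMap.finrank_range_add_finrank_ker B.mulVecLin
  let e : (S → K) →ₗ[K] (ι → K) := Function.ExtendByZero.linearMap K ((↑) : S → ι)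
  have he : ∀ (x : S → K) (q : S), e x q = x q := fun x q =>
    Subtype.val_injective.extend_apply x (0 : ι → K) q
  have he' : ∀ (x : S → K) (q : ι), q ∉ S → e x q = 0 := fun x q hq =>
    Function.extend_apply' x (0 : ι → K) q (by rintro ⟨a, rfl⟩; exact hq a.2)
  have hinj : Function.Injective e := fun x y h => by
    ext q; rw [← he x, ← he y, h]
  have hle : (LinearMap.ker B.mulVecLin).map e ≤ LinearMap.ker A.mulVecLin := by
    rintro _ ⟨x, hx, rfl⟩
    have hx : B *ᵥ x = 0 := by simpa using hx
    rw [LinearMap.mem_ker, Matrix.mulVecLin_apply]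
    have key : ∀ p, (A *ᵥ e x) p = ∑ q : S, A p q * x q := by
      intro p
      simp only [Matrix.mulVec, dotProduct]
      rw [← Finset.sum_subset (Finset.subset_univ S)
        (fun y _ hy => by simp [he' x y hy]), ← Finset.sum_coe_sort S]
      exact Finset.sum_congr rfl fun y _ => by rw [he]
    ext p
    rw [key]
    by_cases hp : p ∈ S
    · exact congrFun hx ⟨p, hp⟩
    · exact Finset.sum_eq_zero fun q _ => by rw [hS p q hp q.2, zero_mul]
  have h3 := Submodule.finrank_mono hle
  rw [(LinearEquiv.finrank_eq (Submodule.equivMapOfInjective e hinj _)).symm] at h3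
  simp only [Module.finrank_pi, Fintype.card_coe] at h1 h2
  simp only [Matrix.rank]
  omega

/-- A nilpotent matrix supported on a preorder which has an antichain with `r` elements has corank
at least `r`. -/
theorem SupportedOn.rank_add_card_antichain_le {ι K : Type*} [Fintype ι] [DecidableEq ι] [Field K]
    {R : ι → ι → Prop} [IsTrans ι R] [Std.Refl R] {A : Matrix ι ι K} (hA : SupportedOn R A)
    (hnil : IsNilpotent A) {r : ℕ} (x : Fin r → ι) (hx : ∀ k l, R (x k) (x l) → k = l) :
    A.rank + r ≤ Fintype.card ι := by
  classical
  let S : Finset ι := Finset.univ.filter fun q => ∃ k, R q (x k)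
  have hS : ∀ q, q ∈ S ↔ ∃ k, R q (x k) := fun q => by simp [S]
  choose w hw0 hwR hwA using fun k => hA.exists_vecMul_eq_zero hnil (x k)
  have hwS : ∀ k p, w k p ≠ 0 → p ∈ S := fun k p h => (hS p).2 ⟨k, (hwR k p h).1⟩
  have hdisj : ∀ k l p, w k p ≠ 0 → w l p ≠ 0 → k = l := fun k l p hk hl =>
    hx k l (_root_.trans (hwR k p hk).2 (hwR l p hl).1)
  let W : Matrix (Fin r) S K := fun k p => w k p
  have hW : LinearIndependent K W := by
    rw [Fintype.linearIndependent_iff]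
    intro g hg k
    obtain ⟨p, hp⟩ := Function.ne_iff.1 (hw0 k)
    have h := congrFun hg ⟨p, hwS k p hp⟩
    simp only [Finset.sum_apply, Pi.smul_apply, smul_eq_mul, Pi.zero_apply] at h
    rw [Finset.sum_eq_single k] at h
    · exact (mul_eq_zero.1 h).resolve_right hp
    · intro l _ hl
      by_contra hne
      exact hl (hdisj l k p (right_ne_zero_of_mul hne) hp)
    · simp
  have hmul : W * A.submatrix ((↑) : S → ι) ((↑) : S → ι) = 0 := by
    ext k q
    have hsum : (w k ᵥ* A) q = 0 := by
      obtain ⟨l, hl⟩ := (hS q).1 q.2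
      by_cases hkl : k = l
      · exact hwA k q (hkl ▸ hl)
      · refine Finset.sum_eq_zero fun p _ => ?_
        by_contra hne
        exact hkl (hx k l (_root_.trans (hwR k p (left_ne_zero_of_mul hne)).2
          (_root_.trans (hA p q (right_ne_zero_of_mul hne)) hl)))
    rw [Matrix.mul_apply, Matrix.zero_apply, ← hsum]
    simp only [Matrix.vecMul, dotProduct]
    rw [← Finset.sum_subset (Finset.subset_univ S) (fun y _ hy => by
      rw [show w k y = 0 from by_contra fun h => hy (hwS k y h), zero_mul]),
      ← Finset.sum_coe_sort S]
    rfl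
  have h1 := Matrix.rank_add_rank_le_card_of_mul_eq_zero hmul
  have h2 := A.rank_add_card_le_rank_submatrix_add S fun p q hp hq => by
    by_contra hne
    obtain ⟨k, hk⟩ := (hS q).1 hq
    exact hp ((hS p).2 ⟨k, _root_.trans (hA p q hne) hk⟩)
  rw [hW.rank_matrix, Fintype.card_fin, Fintype.card_coe] at h1
  omega

section jordan

variable {K : Type*} [Field K] {t : ℕ} {μ : Fin t → ℕ}

lemma sigma_fin_ext {p q : Σ i : Fin t, Fin (μ i)} (h1 : p.1 = q.1)
    (h2 : (p.2 : ℕ) = q.2) : p = q := by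
  obtain ⟨i, a⟩ := p
  obtain ⟨j, b⟩ := q
  obtain rfl : i = j := h1
  exact congrArg (Sigma.mk i) (Fin.ext h2)

lemma mul_jordanMatrix_succ (A : Matrix (Σ i : Fin t, Fin (μ i)) (Σ i : Fin t, Fin (μ i)) K)
    (p : Σ i : Fin t, Fin (μ i)) (j : Fin t) (b : ℕ) (h : b + 1 < μ j) :
    (A * jordanMatrix K t μ) p ⟨j, b + 1, h⟩ = A p ⟨j, b, by omega⟩ := by
  rw [Matrix.mul_apply, Finset.sum_eq_single ⟨j, b, by omega⟩]
  · simp [jordanMatrix]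
  · intro x _ hx
    rw [jordanMatrix, if_neg, mul_zero]
    rintro ⟨h1, h2⟩
    exact hx (sigma_fin_ext h1 (Nat.succ_injective h2))
  · simp

lemma mul_jordanMatrix_zero (A : Matrix (Σ i : Fin t, Fin (μ i)) (Σ i : Fin t, Fin (μ i)) K)
    (p : Σ i : Fin t, Fin (μ i)) (j : Fin t) (h : 0 < μ j) :
    (A * jordanMatrix K t μ) p ⟨j, 0, h⟩ = 0 := by
  rw [Matrix.mul_apply]
  exact Finset.sum_eq_zero fun x _ => by simp [jordanMatrix]

lemma jordanMatrix_mul_of_lt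
    (A : Matrix (Σ i : Fin t, Fin (μ i)) (Σ i : Fin t, Fin (μ i)) K)
    (q : Σ i : Fin t, Fin (μ i)) (i : Fin t) (a : ℕ) (h : a + 1 < μ i) :
    (jordanMatrix K t μ * A) ⟨i, a, by omega⟩ q = A ⟨i, a + 1, h⟩ q := by
  rw [Matrix.mul_apply, Finset.sum_eq_single ⟨i, a + 1, h⟩]
  · simp [jordanMatrix]
  · intro x _ hx
    rw [jordanMatrix, if_neg, zero_mul]
    rintro ⟨h1, h2⟩
    exact hx (sigma_fin_ext h1.symm h2.symm)
  · simp

lemma jordanMatrix_mul_of_eq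
    (A : Matrix (Σ i : Fin t, Fin (μ i)) (Σ i : Fin t, Fin (μ i)) K)
    (q : Σ i : Fin t, Fin (μ i)) (i : Fin t) (a : ℕ) (h : a + 1 = μ i) :
    (jordanMatrix K t μ * A) ⟨i, a, by omega⟩ q = 0 := by
  rw [Matrix.mul_apply]
  refine Finset.sum_eq_zero fun x _ => ?_
  rw [jordanMatrix, if_neg, zero_mul]
  rintro ⟨rfl, h2⟩
  have := x.2.2
  simp only at h2 h
  omega

/-- The pairs of basis vectors which can be linked by an entry of a matrix commuting with the
Jordan matrix. -/
def JordanLE (μ : Fin t → ℕ) (p q : Σ i : Fin t, Fin (μ i)) : Prop :=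
  (p.2 : ℕ) ≤ q.2 ∧ μ q.1 + p.2 ≤ μ p.1 + q.2

instance : IsTrans (Σ i : Fin t, Fin (μ i)) (JordanLE μ) where
  trans _ _ _ h1 h2 := by unfold JordanLE at *; omega

instance : Std.Refl (JordanLE μ) where
  refl _ := ⟨le_rfl, le_rfl⟩

lemma supportedOn_jordanLE_of_commute
    {A : Matrix (Σ i : Fin t, Fin (μ i)) (Σ i : Fin t, Fin (μ i)) K}
    (hA : A * jordanMatrix K t μ = jordanMatrix K t μ * A) : SupportedOn (JordanLE μ) A := by
  have low : ∀ (b : ℕ) (i j : Fin t) (a : ℕ) (ha : a < μ i) (hb : b < μ j),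
      A ⟨i, a, ha⟩ ⟨j, b, hb⟩ ≠ 0 → a ≤ b := by
    intro b
    induction b with
    | zero =>
      intro i j a ha hb hne
      cases a with
      | zero => exact le_rfl
      | succ a =>
        rw [← jordanMatrix_mul_of_lt A _ i a ha, ← hA, mul_jordanMatrix_zero] at hne
        exact absurd rfl hne
    | succ b ih =>
      intro i j a ha hb hne
      cases a with
      | zero => exact Nat.zero_le _
      | succ a =>
        rw [← jordanMatrix_mul_of_lt A _ i a ha, ← hA, mul_jordanMatrix_succ] at hne
        exact Nat.succ_le_succ (ih _ _ _ _ _ hne)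
  have high : ∀ (d : ℕ) (i j : Fin t) (a b : ℕ) (ha : a < μ i) (hb : b < μ j),
      a + 1 + d = μ i → A ⟨i, a, ha⟩ ⟨j, b, hb⟩ ≠ 0 → μ j + a ≤ μ i + b := by
    intro d
    induction d with
    | zero =>
      intro i j a b ha hb had hne
      by_contra hlt
      rw [← mul_jordanMatrix_succ A ⟨i, a, ha⟩ j b (by omega), hA,
        jordanMatrix_mul_of_eq A _ i a had] at hne
      exact hne rfl
    | succ d ih =>
      intro i j a b ha hb had hne
      by_cases hb' : b + 1 < μ j
      · rw [← mul_jordanMatrix_succ A ⟨i, a, ha⟩ j b hb', hA,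
          jordanMatrix_mul_of_lt A _ i a (by omega)] at hne
        have := ih i j (a + 1) (b + 1) _ _ (by omega) hne
        omega
      · omega
  rintro ⟨i, a, ha⟩ ⟨j, b, hb⟩ hne
  exact ⟨low b i j a ha hb hne, high (μ i - (a + 1)) i j a b ha hb (by omega) hne⟩

/-- The matrix sending the generator of the block `j` to the shift by `s j` of the generator of
the block `σ j`. -/
def blockShift (K : Type*) [Field K] (μ : Fin t → ℕ) (σ : Fin t → Fin t) (s : Fin t → ℕ) :
    Matrix (Σ i : Fin t, Fin (μ i)) (Σ i : Fin t, Fin (μ i)) K :=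
  fun p q => if σ q.1 = p.1 ∧ μ p.1 + q.2 = μ q.1 + s q.1 + p.2 then 1 else 0

lemma blockShift_commute (σ : Fin t → Fin t) (s : Fin t → ℕ)
    (h : ∀ j, μ (σ j) ≤ μ j + s j) :
    blockShift K μ σ s * jordanMatrix K t μ = jordanMatrix K t μ * blockShift K μ σ s := by
  ext ⟨i, a, ha⟩ ⟨j, b, hb⟩
  have hj := h j
  by_cases hai : a + 1 < μ i
  · rw [jordanMatrix_mul_of_lt _ _ i a hai]
    cases b with
    | zero =>
      rw [mul_jordanMatrix_zero, blockShift, if_neg]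
      rintro ⟨rfl, h2⟩
      simp only at h2
      omega
    | succ b =>
      rw [mul_jordanMatrix_succ]
      simp only [blockShift]
      congr 1
      simp only [eq_iff_iff, and_congr_right_iff]
      omega
  · rw [jordanMatrix_mul_of_eq _ _ i a (by omega)]
    cases b with
    | zero => rw [mul_jordanMatrix_zero]
    | succ b =>
      rw [mul_jordanMatrix_succ, blockShift, if_neg]
      rintro ⟨rfl, h2⟩
      simp only at h2 ha hai
      omega

lemma blockShift_isNilpotent (σ : Fin t → Fin t) (s : Fin t → ℕ)
    (h : ∀ j, s j = 0 → j < σ j) : IsNilpotent (blockShift K μ σ s) := by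
  let wt : (Σ i : Fin t, Fin (μ i)) → ℕ := fun p => (μ p.1 - 1 - p.2) * t + p.1
  have key : ∀ n p q, (blockShift K μ σ s ^ n) p q ≠ 0 → wt q + n ≤ wt p := by
    intro n
    induction n with
    | zero =>
      intro p q hne
      rw [pow_zero, Matrix.one_apply] at hne
      obtain rfl : p = q := by by_contra h'; simp [h'] at hne
      exact le_rfl
    | succ n ih =>
      intro p q hne
      rw [pow_succ, Matrix.mul_apply] at hne
      obtain ⟨x, -, hx⟩ := Finset.exists_ne_zero_of_sum_ne_zero hne
      have h1 := ih p x (left_ne_zero_of_mul hx)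
      have h2 := right_ne_zero_of_mul hx
      rw [blockShift, ite_ne_right_iff] at h2
      obtain ⟨⟨hσ, he⟩, -⟩ := h2
      have hq := q.2.2
      have hxx := x.2.2
      suffices wt q + 1 ≤ wt x by omega
      have hd : μ x.1 - 1 - x.2 = μ q.1 - 1 - q.2 + s q.1 := by omega
      simp only [wt, hd]
      rcases Nat.eq_zero_or_pos (s q.1) with h0 | h0
      · have := h _ h0
        rw [hσ, Fin.lt_def] at this
        rw [h0]
        simp only [add_zero]
        omega
      · have := q.1.2
        have : t ≤ s q.1 * t := Nat.le_mul_of_pos_left _ h0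
        rw [add_mul]
        omega
  refine ⟨(Finset.univ.sup wt) + 1, ?_⟩
  ext p q
  by_contra hne
  have h1 := key _ p q hne
  have h2 := Finset.le_sup (f := wt) (Finset.mem_univ p)
  omega

lemma card_le_rank_blockShift_add {r : ℕ} (σ : Fin t → Fin t) (s : Fin t → ℕ)
    (h : ∀ j, μ (σ j) ≤ μ j + s j) (e : Fin r → Σ i : Fin t, Fin (μ i))
    (he : ∀ p, p ∉ Set.range e → ∃ j, σ j = p.1 ∧ s j + p.2 < μ p.1) :
    ∑ i, μ i ≤ (blockShift K μ σ s).rank + r := by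
  classical
  have htop : LinearMap.range (blockShift K μ σ s).mulVecLin ⊔
      Submodule.span K (Set.range fun k => Pi.single (e k) (1 : K)) = ⊤ := by
    rw [eq_top_iff, ← (Pi.basisFun K (Σ i : Fin t, Fin (μ i))).span_eq, Submodule.span_le]
    rintro _ ⟨p, rfl⟩
    rw [Pi.basisFun_apply]
    by_cases hp : p ∈ Set.range e
    · obtain ⟨k, rfl⟩ := hp
      exact Submodule.mem_sup_right (Submodule.subset_span ⟨k, rfl⟩)
    · obtain ⟨j, hj, hlt⟩ := he p hp
      have hμ := h j
      rw [hj] at hμ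
      refine Submodule.mem_sup_left ⟨Pi.single ⟨j, μ j + s j + p.2 - μ p.1, by omega⟩ 1, ?_⟩
      rw [Matrix.mulVecLin_apply, Matrix.mulVec_single_one]
      ext x
      rw [Matrix.col_apply, blockShift]
      by_cases hx : x = p
      · subst hx
        rw [Pi.single_eq_same, if_pos]
        refine ⟨hj, ?_⟩
        simp only
        omega
      · rw [Pi.single_eq_of_ne hx, if_neg]
        rintro ⟨h1, h2⟩
        have h3 : p.1 = x.1 := hj.symm.trans h1
        refine hx (sigma_fin_ext h3.symm ?_)
        have h4 : μ p.1 = μ x.1 := congrArg μ h3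
        simp only at h2
        omega
  have h1 := Submodule.finrank_add_le_finrank_add_finrank
    (LinearMap.range (blockShift K μ σ s).mulVecLin)
    (Submodule.span K (Set.range fun k => Pi.single (e k) (1 : K)))
  rw [htop, finrank_top, Module.finrank_pi] at h1
  have h2 := finrank_range_le_card (R := K) (fun k => Pi.single (M := fun _ => K) (e k) (1 : K))
  rw [Set.finrank, Fintype.card_fin] at h2
  simp only [Fintype.card_sigma, Fintype.card_fin] at h1
  simp only [Matrix.rank]
  omega

end jordan

section partition

variable {t : ℕ} {μ : Fin t → ℕ}

lemma exists_isConcatAR_and_gaps (hmono : Antitone μ) :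
    ∃ p, IsConcatAR t μ p ∧ ∃ i : Fin p → Fin t,
      ∀ k l, k ≤ l → μ (i l) + 2 * l ≤ μ (i k) + 2 * k := by
  have hex : ∀ x : ℕ, ∃ y, x < y ∧ (x < t → y ≤ t ∧
      (∀ i j : Fin t, x ≤ i → (i : ℕ) < y → x ≤ j → (j : ℕ) < y → μ i ≤ μ j + 1) ∧
      (∀ i j : Fin t, (i : ℕ) = x → (j : ℕ) = y → μ j + 2 ≤ μ i)) := by
    intro x
    by_cases hx : x < t
    · have hP : ∃ y, x < y ∧ ∀ j : Fin t, (j : ℕ) = y → μ j + 2 ≤ μ ⟨x, hx⟩ :=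
        ⟨t, hx, fun j hj => absurd hj j.2.ne⟩
      classical
      refine ⟨Nat.find hP, (Nat.find_spec hP).1, fun _ => ⟨?_, ?_, ?_⟩⟩
      · exact Nat.find_min' hP ⟨hx, fun j hj => absurd hj j.2.ne⟩
      · intro i j hi _ hj hjy
        have h1 : μ i ≤ μ ⟨x, hx⟩ := hmono hi
        rcases hj.eq_or_lt with h | h
        · have : μ i ≤ μ j := hmono (Fin.le_def.2 (by omega))
          omega
        · have h2 := Nat.find_min hP hjy
          by_contra hlt
          refine h2 ⟨h, fun j' hj' => ?_⟩
          obtain rfl : j' = j := Fin.ext hj'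
          omega
      · intro i j hi hj
        obtain rfl : i = ⟨x, hx⟩ := Fin.ext hi
        exact (Nat.find_spec hP).2 j hj
    · exact ⟨x + 1, Nat.lt_succ_self x, fun h => absurd h hx⟩
  choose N hN hN' using hex
  let c : ℕ → ℕ := fun k => N^[k] 0
  have hcs : ∀ k, c (k + 1) = N (c k) := fun k => Function.iterate_succ_apply' N k 0
  have hc : StrictMono c := strictMono_nat_of_lt_succ fun k => by rw [hcs]; exact hN _
  have hP : ∃ k, t ≤ c k := ⟨t, hc.id_le t⟩
  obtain ⟨p, hp, hlt⟩ : ∃ p, t ≤ c p ∧ ∀ k < p, c k < t := by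
    classical
    exact ⟨Nat.find hP, Nat.find_spec hP, fun k hk => not_le.1 (Nat.find_min hP hk)⟩
  refine ⟨p, ⟨fun k => c k, rfl, ?_, fun k l hkl => hc hkl, ?_⟩,
    fun k => ⟨c k, hlt k k.2⟩, ?_⟩
  · simp only [Fin.val_last]
    refine le_antisymm ?_ hp
    cases p with
    | zero => exact Nat.zero_le _
    | succ p => rw [hcs]; exact (hN' _ (hlt p (Nat.lt_succ_self p))).1
  · intro k i j
    simp only [Fin.val_castSucc, Fin.val_succ, hcs]
    exact (hN' _ (hlt k k.2)).2.1 i j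
  · have step : ∀ d k : ℕ, ∀ h : k + d < p,
        μ ⟨c (k + d), hlt _ h⟩ + 2 * (k + d) ≤ μ ⟨c k, hlt k (by omega)⟩ + 2 * k := by
      intro d
      induction d with
      | zero => intro k h; exact le_rfl
      | succ d ih =>
        intro k h
        have h1 := ih k (by omega)
        have h2 := (hN' _ (hlt (k + d) (by omega))).2.2 ⟨c (k + d), hlt _ (by omega)⟩
          ⟨c (k + (d + 1)), hlt _ h⟩ rfl (hcs (k + d))
        omega
    intro k l hkl
    obtain ⟨d, hd⟩ := Nat.exists_eq_add_of_le (Fin.le_def.1 hkl)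
    have h1 := step d k (by have := l.2; omega)
    simpa only [← hd] using h1

lemma IsConcatAR.exists_rotation {r : ℕ} (hpos : ∀ i, 0 < μ i) (hmono : Antitone μ)
    (hr : IsConcatAR t μ r) :
    ∃ (σ : Fin t → Fin t) (s : Fin t → ℕ) (e : Fin r → Σ i : Fin t, Fin (μ i)),
      (∀ j, μ (σ j) ≤ μ j + s j) ∧ (∀ j, s j = 0 → j < σ j) ∧
      ∀ p, p ∉ Set.range e → ∃ j, σ j = p.1 ∧ s j + p.2 < μ p.1 := by
  obtain ⟨c, hc0, hct, hc, hAR⟩ := hr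
  have hle : ∀ k, c k ≤ t := fun k => hct ▸ hc.monotone (Fin.le_last k)
  have hlt : ∀ k : Fin r, c k.castSucc < c k.succ := fun k => hc Fin.castSucc_lt_succ
  have hct' : ∀ k : Fin r, c k.castSucc < t := fun k => (hlt k).trans_le (hle _)
  have hseg : ∀ j : Fin t, ∃ k : Fin r, c k.castSucc ≤ j ∧ (j : ℕ) < c k.succ := by
    intro j
    by_contra! hcon
    have : ∀ k : Fin (r + 1), c k ≤ j := by
      intro k
      induction k using Fin.induction with
      | zero => omega
      | succ k ih => exact hcon k ih
    have := this (Fin.last r)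
    have := j.2
    omega
  choose g hg1 hg2 using hseg
  have huniq : ∀ (j : Fin t) (k : Fin r), c k.castSucc ≤ j → (j : ℕ) < c k.succ → g j = k := by
    intro j k h1 h2
    have a1 := hc.lt_iff_lt.1 ((hg1 j).trans_lt h2)
    have a2 := hc.lt_iff_lt.1 (h1.trans_lt (hg2 j))
    rw [Fin.lt_def, Fin.val_castSucc, Fin.val_succ] at a1 a2
    exact Fin.ext (by omega)
  refine ⟨fun j => if h : (j : ℕ) + 1 < c (g j).succ then ⟨j + 1, h.trans_le (hle _)⟩
      else ⟨c (g j).castSucc, hct' _⟩,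
    fun j => if (j : ℕ) + 1 < c (g j).succ then 0 else 1,
    fun k => ⟨⟨c k.castSucc, hct' k⟩, μ ⟨c k.castSucc, hct' k⟩ - 1,
      Nat.sub_lt (hpos _) one_pos⟩, ?_, ?_, ?_⟩
  · intro j
    beta_reduce
    split_ifs with h
    · exact hmono (Fin.le_def.2 (Nat.le_succ _))
    · exact hAR (g j) _ j le_rfl (hlt _) (hg1 j) (hg2 j)
  · intro j
    beta_reduce
    split_ifs with h
    · exact fun _ => Fin.lt_def.2 (Nat.lt_succ_self _)
    · simp
  · rintro ⟨i, a, ha⟩ hp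
    by_cases hi : (i : ℕ) = c (g i).castSucc
    · have hl := hlt (g i)
      have hl' := hle (g i).succ
      let j : Fin t := ⟨c (g i).succ - 1, by omega⟩
      have hj : (j : ℕ) = c (g i).succ - 1 := rfl
      have hgj : g j = g i := huniq j (g i) (by omega) (by omega)
      have hn : ¬ ((j : ℕ) + 1 < c (g j).succ) := by rw [hgj]; omega
      refine ⟨j, ?_, ?_⟩ <;> beta_reduce
      · rw [dif_neg hn]
        exact Fin.ext (by rw [hgj]; exact hi.symm)
      · rw [if_neg hn]
        by_contra hlt'
        refine hp ⟨g i, sigma_fin_ext (Fin.ext hi.symm) ?_⟩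
        have : (⟨c (g i).castSucc, hct' (g i)⟩ : Fin t) = i := Fin.ext hi.symm
        simp only [this]
        simp only at hlt'
        omega
    · have h1 := hg1 i
      have h2 := hg2 i
      let j : Fin t := ⟨i - 1, by omega⟩
      have hj : (j : ℕ) = i - 1 := rfl
      have hgj : g j = g i := huniq j (g i) (by omega) (by omega)
      have hn : (j : ℕ) + 1 < c (g j).succ := by rw [hgj]; omega
      refine ⟨j, ?_, ?_⟩ <;> beta_reduce
      · rw [dif_pos hn]
        exact Fin.ext (by simp only; omega)
      · rw [if_pos hn, zero_add]
        exact ha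

end partition

lemma rank_add_le_of_gaps {K : Type*} [Field K] {t : ℕ} {μ : Fin t → ℕ} (hpos : ∀ i, 0 < μ i)
    {A : Matrix (Σ i : Fin t, Fin (μ i)) (Σ i : Fin t, Fin (μ i)) K}
    (hA : A * jordanMatrix K t μ = jordanMatrix K t μ * A) (hnil : IsNilpotent A)
    {p : ℕ} (i : Fin p → Fin t)
    (hi : ∀ k l, k ≤ l → μ (i l) + 2 * l ≤ μ (i k) + 2 * k) :
    A.rank + p ≤ ∑ i, μ i := by
  have hp : ∀ k : Fin p, p ≤ μ (i k) + k := fun k => by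
    have hk := k.2
    have h1 := hi k ⟨p - 1, by omega⟩ (Fin.le_def.2 (by simp only; omega))
    have h2 := hpos (i ⟨p - 1, by omega⟩)
    simp only at h1
    omega
  have h := (supportedOn_jordanLE_of_commute hA).rank_add_card_antichain_le hnil
    (fun k : Fin p => (⟨i k, μ (i k) + k - p, by have := k.2; have := hpos (i k); omega⟩ :
      Σ i : Fin t, Fin (μ i))) ?_
  · simpa only [Fintype.card_sigma, Fintype.card_fin] using h
  · rintro k l ⟨h1, h2⟩
    have hk := hp k
    have hl := hp l
    simp only at h1 h2
    rcases le_total k l with hkl | hkl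
    · have := hi k l hkl
      have := Fin.le_def.1 hkl
      exact Fin.ext (by omega)
    · have := hi l k hkl
      have := Fin.le_def.1 hkl
      exact Fin.ext (by omega)

/-- If `K` is infinite and `r = r_B` is the minimal number of almost rectangular partitions
whose concatenation is `B`, then every nilpotent `A` commuting with the Jordan matrix `J` of
type `B` has `rank A ≤ n - r_B`, and some such `A` has `rank A = n - r_B`
(i.e. exactly `r_B` Jordan blocks). -/
theorem max_rank_in_centralizer
    (K : Type*) [Field K] [Infinite K]
    (t : ℕ) (μ : Fin t → ℕ) (hpos : ∀ i, 0 < μ i)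
    (hmono : ∀ i j : Fin t, i ≤ j → μ j ≤ μ i)
    (r : ℕ) (hr : IsLeast {p | IsConcatAR t μ p} r) :
    (∀ A : Matrix (Σ i : Fin t, Fin (μ i)) (Σ i : Fin t, Fin (μ i)) K,
        A * jordanMatrix K t μ = jordanMatrix K t μ * A → IsNilpotent A →
        A.rank ≤ (∑ i, μ i) - r) ∧
    (∃ A : Matrix (Σ i : Fin t, Fin (μ i)) (Σ i : Fin t, Fin (μ i)) K,
        A * jordanMatrix K t μ = jordanMatrix K t μ * A ∧ IsNilpotent A ∧
        A.rank = (∑ i, μ i) - r) := by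
  obtain ⟨hr, hmin⟩ := hr
  have hanti : Antitone μ := hmono
  obtain ⟨p, hp, i, hi⟩ := exists_isConcatAR_and_gaps hanti
  have hrp : r ≤ p := hmin hp
  have upper : ∀ A : Matrix (Σ i : Fin t, Fin (μ i)) (Σ i : Fin t, Fin (μ i)) K,
      A * jordanMatrix K t μ = jordanMatrix K t μ * A → IsNilpotent A →
      A.rank ≤ (∑ i, μ i) - r := fun A hA hnil => by
    have := rank_add_le_of_gaps hpos hA hnil i hi
    omega
  obtain ⟨σ, s, e, h1, h2, h3⟩ := hr.exists_rotation hpos hanti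
  have hcomm := blockShift_commute (K := K) σ s h1
  have hnil := blockShift_isNilpotent (K := K) (μ := μ) σ s h2
  have hrank := card_le_rank_blockShift_add (K := K) σ s h1 e h3
  exact ⟨upper, blockShift K μ σ s, hcomm, hnil,
    le_antisymm (upper _ hcomm hnil) (by omega)⟩
end
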